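/- Let H be a set of increasing functions from ℝ to ℝ. For random variables V, W write V ≥_H^I W if E h(V) ≥ E h(W) for every h ∈ H (whenever the expectations exist), and say that the order ≥_H^I is preserved under H-transformations if V ≥_H^I W implies h(V) ≥_H^I h(W) for every h ∈ H. Let G be a continuous, strictly increasing CDF, let F be a CDF with F^{-1} ∘ G ∈ H, and let 1 ≤ i ≤ n, 1 ≤ j ≤ m. If G^{-1}(B_{i:n}) ≥_H^I G^{-1}(B_{j:m}) and ≥_H^I is preserved under H-transformations, then E h(X_{i:n}) ≥ E h(X_{j:m}) for every h ∈ H for which the expectations exist. -/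

import Mathlib

open MeasureTheory Set Filter

/-- Generalized inverse (quantile function) `F⁻¹(p) = inf {x | p ≤ F x}` of a CDF `F`. -/
noncomputable def qf (F : ℝ → ℝ) (p : ℝ) : ℝ := sInf {x | p ≤ F x}

/-- `F` is a cumulative distribution function: monotone, right-continuous, with limits
`0` at `-∞` and `1` at `+∞`. -/
def IsCDF (F : ℝ → ℝ) : Prop :=
  Monotone F ∧ (∀ x, ContinuousWithinAt F (Set.Ici x) x) ∧
    Tendsto F atBot (nhds 0) ∧ Tendsto F atTop (nhds 1)

/-- The (real) Beta function `B(a,b) = ∫₀¹ t^(a-1) (1-t)^(b-1) dt`. -/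
noncomputable def Bfun (a b : ℝ) : ℝ :=
  ∫ t in Set.Ioo (0:ℝ) 1, t ^ (a - 1) * (1 - t) ^ (b - 1)

/-- The Beta(i, n-i+1) distribution on `ℝ`, i.e. the law of the `i`-th order statistic
`B_{i:n}` of an i.i.d. uniform sample of size `n`. -/
noncomputable def betaLaw (i n : ℕ) : Measure ℝ :=
  (volume.restrict (Set.Ioo (0:ℝ) 1)).withDensity fun t =>
    ENNReal.ofReal (t ^ ((i:ℝ) - 1) * (1 - t) ^ ((n:ℝ) - (i:ℝ)) / Bfun (i:ℝ) ((n:ℝ) - (i:ℝ) + 1))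

/-- The law of the `i`-th order statistic `X_{i:n}` of an i.i.d. sample of size `n` from the
CDF `F`: the pushforward of the Beta(i, n-i+1) measure under the quantile function `F⁻¹`. -/
noncomputable def osLaw (F : ℝ → ℝ) (i n : ℕ) : Measure ℝ := (betaLaw i n).map (qf F)

/-- The `k`-th harmonic number `H_k = ∑_{r=1}^k 1/r`. -/
noncomputable def harm (k : ℕ) : ℝ := ∑ r ∈ Finset.Icc 1 k, (1:ℝ) / r

/-- `IOrd H μ ν` : the `H`-integral stochastic order `≥_H^I` between laws: `E h(X) ≥ E h(Y)`
for every `h ∈ H` whenever the expectations exist (here `μ` is the law of `X`, `ν` of `Y`). -/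
def IOrd (H : Set (ℝ → ℝ)) (μ ν : MeasureTheory.Measure ℝ) : Prop :=
  ∀ h ∈ H, MeasureTheory.Integrable h μ → MeasureTheory.Integrable h ν →
    ∫ x, h x ∂ν ≤ ∫ x, h x ∂μ

/-- The integral order `≥_H^I` is preserved under `H`-transformations. -/
def PreservedUnder (H : Set (ℝ → ℝ)) : Prop :=
  ∀ h ∈ H, ∀ μ ν : MeasureTheory.Measure ℝ, IOrd H μ ν →
    IOrd H (μ.map h) (ν.map h)

theorem qf_apply_aux (G : ℝ → ℝ) (hGmono : StrictMono G) (x : ℝ) : qf G (G x) = x := by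
  have : {y | G x ≤ G y} = Set.Ici x := by
    ext y
    simp [hGmono.le_iff_le]
  unfold qf
  rw [this, csInf_Ici]

theorem exists_apply_aux (G : ℝ → ℝ) (hG : IsCDF G) (hGcont : Continuous G) {p : ℝ}
    (hp : p ∈ Set.Ioo (0:ℝ) 1) : ∃ x, G x = p := by
  obtain ⟨-, -, h0, h1⟩ := hG
  obtain ⟨a, ha⟩ := (h0.eventually_lt_const hp.1).exists
  obtain ⟨b, hb⟩ := (h1.eventually_const_lt hp.2).exists
  exact mem_range_of_exists_le_of_exists_ge hGcont ⟨a, ha.le⟩ ⟨b, hb.le⟩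

theorem osLaw_eq_aux (G : ℝ → ℝ) (hG : IsCDF G) (hGcont : Continuous G) (hGmono : StrictMono G)
    (F : ℝ → ℝ) (hm : Monotone (fun x => qf F (G x))) (i n : ℕ) :
    osLaw F i n = ((betaLaw i n).map (qf G)).map (fun x => qf F (G x)) := by
  have hac : betaLaw i n ≪ volume.restrict (Set.Ioo (0:ℝ) 1) := withDensity_absolutelyContinuous _ _
  have hmon : MonotoneOn (qf G) (Set.Ioo (0:ℝ) 1) := by
    intro p hp q hq hpq
    obtain ⟨x, rfl⟩ := exists_apply_aux G hG hGcont hp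
    obtain ⟨y, rfl⟩ := exists_apply_aux G hG hGcont hq
    rw [qf_apply_aux G hGmono, qf_apply_aux G hGmono]
    exact hGmono.le_iff_le.1 hpq
  have hae : AEMeasurable (qf G) (betaLaw i n) :=
    (aemeasurable_restrict_of_monotoneOn measurableSet_Ioo hmon).mono_ac hac
  rw [AEMeasurable.map_map_of_aemeasurable hm.measurable.aemeasurable hae]
  unfold osLaw
  apply Measure.map_congr
  apply hac.ae_le
  filter_upwards [ae_restrict_mem measurableSet_Ioo] with p hp
  obtain ⟨x, rfl⟩ := exists_apply_aux G hG hGcont hp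
  simp [qf_apply_aux G hGmono]

/-- If `F⁻¹ ∘ G ∈ H`, `G⁻¹(B_{i:n}) ≥_H^I G⁻¹(B_{j:m})` and `≥_H^I` is
preserved under `H`-transformations, then `E h(X_{i:n}) ≥ E h(X_{j:m})` for every `h ∈ H`
for which the expectations exist. -/
theorem stmt0 (H : Set (ℝ → ℝ)) (hH : ∀ h ∈ H, Monotone h)
    (G : ℝ → ℝ) (hG : IsCDF G) (hGcont : Continuous G) (hGmono : StrictMono G)
    (F : ℝ → ℝ) (hF : IsCDF F)
    (i n j m : ℕ) (hi1 : 1 ≤ i) (hin : i ≤ n) (hj1 : 1 ≤ j) (hjm : j ≤ m)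
    (hFG : (fun x => qf F (G x)) ∈ H)
    (hdom : IOrd H ((betaLaw i n).map (qf G)) ((betaLaw j m).map (qf G)))
    (hpres : PreservedUnder H) :
    ∀ h ∈ H, MeasureTheory.Integrable h (osLaw F i n) →
      MeasureTheory.Integrable h (osLaw F j m) →
        ∫ x, h x ∂(osLaw F j m) ≤ ∫ x, h x ∂(osLaw F i n) := by
  have hm := hH _ hFG
  rw [osLaw_eq_aux G hG hGcont hGmono F hm i n, osLaw_eq_aux G hG hGcont hGmono F hm j m]
  exact hpres _ hFG _ _ hdom
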